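/- arXiv:2001.00936 — 2 statements merged into one kernel-verified Lean document; each statement's English description precedes it below -/
import Mathlib

section
/- Compactness: For any set Γ ∪ {φ} of L-sentences, if Γ ⊨ φ then Γ₀ ⊨ φ for some finite subset Γ₀ ⊆ Γ. -/
universe u v

namespace BQL

structure Signature : Type 1 where
  Const : Type
  Func : Type
  arityF : Func → ℕ
  Rel : Type
  arityR : Rel → ℕ

inductive Term (L : Signature) : Type
  | var : ℕ → Term L
  | const : L.Const → Term L
  | func : (f : L.Func) → (Fin (L.arityF f) → Term L) → Term L

inductive Formula (L : Signature) : Type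
  | top : Formula L
  | bot : Formula L
  | rel : (R : L.Rel) → (Fin (L.arityR R) → Term L) → Formula L
  | and : Formula L → Formula L → Formula L
  | or : Formula L → Formula L → Formula L
  | imp : Formula L → Formula L → Formula L
  | all : Formula L → Formula L
  | ex : Formula L → Formula L

variable {L : Signature}

namespace Term

/-- Shift all (free) variables of a term up by one. -/
def shiftUp : Term L → Term L
  | var n => var (n + 1)
  | const c => const c
  | func f ts => func f fun i => (ts i).shiftUp

/-- Apply a simultaneous substitution to a term. -/
def applySub (σ : ℕ → Term L) : Term L → Term L
  | var n => σ n
  | const c => const c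
  | func f ts => func f fun i => (ts i).applySub σ

/-- All variables of the term are `< k`. -/
def ClosedAt : Term L → ℕ → Prop
  | var n, k => n < k
  | const _, _ => True
  | func _ ts, k => ∀ i, (ts i).ClosedAt k

/-- A closed term. -/
def Closed (t : Term L) : Prop := t.ClosedAt 0

/-- The constant `c` occurs in the term. -/
def OccC (c : L.Const) : Term L → Prop
  | var _ => False
  | const d => d = c
  | func _ ts => ∃ i, (ts i).OccC c

end Term

/-- Lift a substitution under a binder. -/
def liftSub (σ : ℕ → Term L) : ℕ → Term L
  | 0 => .var 0
  | n + 1 => (σ n).shiftUp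

namespace Formula

/-- Apply a simultaneous substitution to a formula. -/
def applySub (σ : ℕ → Term L) : Formula L → Formula L
  | top => top
  | bot => bot
  | rel R ts => rel R fun i => (ts i).applySub σ
  | and φ ψ => and (φ.applySub σ) (ψ.applySub σ)
  | or φ ψ => or (φ.applySub σ) (ψ.applySub σ)
  | imp φ ψ => imp (φ.applySub σ) (ψ.applySub σ)
  | all φ => all (φ.applySub (liftSub σ))
  | ex φ => ex (φ.applySub (liftSub σ))

/-- All free variables of the formula are `< k`. -/
def ClosedAt : Formula L → ℕ → Prop
  | top, _ => True
  | bot, _ => True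
  | rel _ ts, k => ∀ i, (ts i).ClosedAt k
  | and φ ψ, k => φ.ClosedAt k ∧ ψ.ClosedAt k
  | or φ ψ, k => φ.ClosedAt k ∧ ψ.ClosedAt k
  | imp φ ψ, k => φ.ClosedAt k ∧ ψ.ClosedAt k
  | all φ, k => φ.ClosedAt (k + 1)
  | ex φ, k => φ.ClosedAt (k + 1)

/-- A sentence: a formula with no free variables. -/
def Sentence (φ : Formula L) : Prop := φ.ClosedAt 0

/-- The constant `c` occurs in the formula. -/
def OccC (c : L.Const) : Formula L → Prop
  | top => False
  | bot => False
  | rel _ ts => ∃ i, (ts i).OccC c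
  | and φ ψ => φ.OccC c ∨ ψ.OccC c
  | or φ ψ => φ.OccC c ∨ ψ.OccC c
  | imp φ ψ => φ.OccC c ∨ ψ.OccC c
  | all φ => φ.OccC c
  | ex φ => φ.OccC c

/-- The formula contains no occurrence of `∨` and no occurrence of `∃`. -/
def NoOrEx : Formula L → Prop
  | top => True
  | bot => True
  | rel _ _ => True
  | and φ ψ => φ.NoOrEx ∧ ψ.NoOrEx
  | or _ _ => False
  | imp φ ψ => φ.NoOrEx ∧ ψ.NoOrEx
  | all φ => φ.NoOrEx
  | ex _ => False

end Formula

/-- Substitute the term `t` for the variable `v₀` (lowering the other variables). -/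
def subst0 (φ : Formula L) (t : Term L) : Formula L :=
  φ.applySub fun n => match n with | 0 => t | n + 1 => .var n

/-- `□ⁿφ`, where `□φ` abbreviates `⊤ → φ`. -/
def boxN : ℕ → Formula L → Formula L
  | 0, φ => φ
  | n + 1, φ => .imp .top (boxN n φ)

/-- The conjunction of a finite list of formulas (`⋀∅ = ⊤`). -/
def conjL : List (Formula L) → Formula L
  | [] => .top
  | [φ] => φ
  | φ :: ψ :: l => .and φ (conjL (ψ :: l))

/-- The language `L⁺`, obtained from `L` by adding countably many fresh constants `aᵢ`. -/
def Signature.plus (L : Signature) : Signature where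
  Const := L.Const ⊕ ℕ
  Func := L.Func
  arityF := L.arityF
  Rel := L.Rel
  arityR := L.arityR

/-- The fresh constant `aᵢ` of `L⁺`. -/
def aconst (L : Signature) (i : ℕ) : Term L.plus := .const (Sum.inr i)

/-- Embedding of `L`-terms into `L⁺`-terms. -/
def Term.emb : Term L → Term L.plus
  | .var n => .var n
  | .const c => .const (Sum.inl c)
  | .func f ts => .func f fun i => (ts i).emb

/-- Embedding of `L`-formulas into `L⁺`-formulas. -/
def Formula.emb : Formula L → Formula L.plus
  | .top => .top
  | .bot => .bot
  | .rel R ts => .rel R fun i => (ts i).emb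
  | .and φ ψ => .and φ.emb ψ.emb
  | .or φ ψ => .or φ.emb ψ.emb
  | .imp φ ψ => .imp φ.emb ψ.emb
  | .all φ => .all φ.emb
  | .ex φ => .ex φ.emb

/-- The fresh constant `aᵢ` occurs in no member of `Γ`. -/
def FreshIn (i : ℕ) (Γ : Set (Formula L.plus)) : Prop :=
  ∀ ψ ∈ Γ, ¬ ψ.OccC (Sum.inr i)

/-- A Kripke `L`-model (the frame conditions are packaged in `KModel.Proper`). -/
structure KModel (L : Signature) : Type (u + 1) where
  W : Type u
  acc : W → W → Prop
  D : Type u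
  interpC : L.Const → D
  interpF : (f : L.Func) → (Fin (L.arityF f) → D) → D
  interpR : (R : L.Rel) → W → Set (Fin (L.arityR R) → D)

/-- The conditions on an `L`-model: nonempty set of worlds, transitive accessibility
relation, nonempty domain, and the persistence constraint. -/
def KModel.Proper (M : KModel.{u} L) : Prop :=
  Nonempty M.W ∧ Nonempty M.D ∧ Transitive M.acc ∧
    ∀ (R : L.Rel) (w u' : M.W), M.acc w u' → M.interpR R w ⊆ M.interpR R u'

/-- Prepend a value to a valuation. -/
def vcons {α : Sort*} (d : α) (ρ : ℕ → α) : ℕ → α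
  | 0 => d
  | n + 1 => ρ n

/-- Denotation of a term. -/
def Term.eval (M : KModel.{u} L) (ρ : ℕ → M.D) : Term L → M.D
  | .var n => ρ n
  | .const c => M.interpC c
  | .func f ts => M.interpF f fun i => (ts i).eval M ρ

/-- The satisfaction relation `w ⊩ φ(ā)`. -/
def Sat (M : KModel.{u} L) : M.W → (ℕ → M.D) → Formula L → Prop
  | _, _, .top => True
  | _, _, .bot => False
  | w, ρ, .rel R ts => (fun i => (ts i).eval M ρ) ∈ M.interpR R w
  | w, ρ, .and φ ψ => Sat M w ρ φ ∧ Sat M w ρ ψ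
  | w, ρ, .or φ ψ => Sat M w ρ φ ∨ Sat M w ρ ψ
  | w, ρ, .imp φ ψ => ∀ u', M.acc w u' → Sat M u' ρ φ → Sat M u' ρ ψ
  | w, ρ, .all φ => ∀ d, Sat M w (vcons d ρ) φ
  | w, ρ, .ex φ => ∃ d, Sat M w (vcons d ρ) φ

/-- Satisfaction of a sentence (under every valuation). -/
def SatS (M : KModel.{u} L) (w : M.W) (φ : Formula L) : Prop := ∀ ρ, Sat M w ρ φ

/-- `Γ ⊨ φ`: truth is preserved at every reflexive world of every `L`-model. -/
def Models (Γ : Set (Formula L)) (φ : Formula L) : Prop :=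
  ∀ M : KModel.{u} L, M.Proper → ∀ w : M.W, M.acc w w →
    (∀ ψ ∈ Γ, SatS M w ψ) → SatS M w φ

/-- `Γ : Δ ⊨ φ`: for every `L`-model, every reflexive world `w` and every world `u ≻ w`:
if `w ⊩ Γ` and `u ⊩ Δ` then `u ⊩ φ`. -/
def ModelsCtx (Γ Δ : Set (Formula L)) (φ : Formula L) : Prop :=
  ∀ M : KModel.{u} L, M.Proper → ∀ w u' : M.W, M.acc w w → M.acc w u' →
    (∀ ψ ∈ Γ, SatS M w ψ) → (∀ ψ ∈ Δ, SatS M u' ψ) → SatS M u' φ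

end BQL

namespace BQL

/-- The product of a family of models modulo an ultrafilter. As the language has no equality,
no quotient is taken: worlds and individuals are plain families. -/
def KModel.ultraproduct {L : Signature} {ι : Type} (U : Ultrafilter ι) (M : ι → KModel.{u} L) :
    KModel.{u} L where
  W := ∀ i, (M i).W
  acc w v := ∀ᶠ i in U, (M i).acc (w i) (v i)
  D := ∀ i, (M i).D
  interpC c i := (M i).interpC c
  interpF f ds i := (M i).interpF f fun j => ds j i
  interpR R w := {ds | ∀ᶠ i in U, (fun j => ds j i) ∈ (M i).interpR R (w i)}

section Ultraproduct

variable {L : Signature} {ι : Type} {U : Ultrafilter ι} {M : ι → KModel.{u} L}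

theorem KModel.Proper.ultraproduct (hM : ∀ i, (M i).Proper) :
    (KModel.ultraproduct U M).Proper := by
  refine ⟨⟨fun i => (hM i).1.some⟩, ⟨fun i => (hM i).2.1.some⟩, ?_, ?_⟩
  · intro a b c hab hbc
    filter_upwards [hab, hbc] with i h₁ h₂ using (hM i).2.2.1 h₁ h₂
  · intro R w v hwv ds hds
    filter_upwards [hwv, hds] with i h₁ h₂ using (hM i).2.2.2 R _ _ h₁ h₂

theorem Term.eval_ultraproduct (ρ : ℕ → (KModel.ultraproduct U M).D) (t : Term L) (i : ι) :
    t.eval (KModel.ultraproduct U M) ρ i = t.eval (M i) fun n => ρ n i := by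
  induction t with
  | var n => rfl
  | const c => rfl
  | func f ts ih => exact congrArg ((M i).interpF f) (funext ih)

theorem vcons_apply {D : ι → Type u} (d : ∀ i, D i) (ρ : ℕ → ∀ i, D i) (i : ι) :
    (fun n => vcons d ρ n i) = vcons (d i) fun n => ρ n i := by
  funext n
  cases n <;> rfl

/-- **Łoś's theorem** for Kripke models. -/
theorem sat_ultraproduct (hM : ∀ i, (M i).Proper) (φ : Formula L)
    (w : (KModel.ultraproduct U M).W) (ρ : ℕ → (KModel.ultraproduct U M).D) :
    Sat (KModel.ultraproduct U M) w ρ φ ↔ ∀ᶠ i in U, Sat (M i) (w i) (fun n => ρ n i) φ := by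
  have : ∀ i, Nonempty (M i).W := fun i => (hM i).1
  have : ∀ i, Nonempty (M i).D := fun i => (hM i).2.1
  induction φ generalizing w ρ with
  | top => simp [Sat]
  | bot => simpa [Sat] using U.neBot.ne
  | rel R ts =>
    simp only [Sat, ← Term.eval_ultraproduct]
    rfl
  | and φ ψ ihφ ihψ => simp only [Sat, ihφ, ihψ, Filter.eventually_and]
  | or φ ψ ihφ ihψ => simp only [Sat, ihφ, ihψ, Ultrafilter.eventually_or]
  | imp φ ψ ihφ ihψ =>
    simp only [Sat, ihφ, ihψ]
    constructor
    · intro h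
      by_contra hn
      rw [← Ultrafilter.eventually_not] at hn
      have hex : ∀ i, ∃ v, (¬ ∀ u', (M i).acc (w i) u' → Sat (M i) u' (fun n => ρ n i) φ →
          Sat (M i) u' (fun n => ρ n i) ψ) → (M i).acc (w i) v ∧
          Sat (M i) v (fun n => ρ n i) φ ∧ ¬ Sat (M i) v (fun n => ρ n i) ψ := by
        intro i
        by_cases hi : ∀ u', (M i).acc (w i) u' → Sat (M i) u' (fun n => ρ n i) φ →
          Sat (M i) u' (fun n => ρ n i) ψ
        · exact ⟨w i, fun h' => absurd hi h'⟩
        · push Not at hi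
          exact hi.imp fun v hv _ => hv
      choose v hv using hex
      have hψ := h v (hn.mono fun i hi => (hv i hi).1) (hn.mono fun i hi => (hv i hi).2.1)
      obtain ⟨i, hi, hi'⟩ := (hn.and hψ).exists
      exact (hv i hi).2.2 hi'
    · intro h v hv hφ
      filter_upwards [h, hv, hφ] with i h₁ h₂ h₃ using h₁ _ h₂ h₃
  | all φ ih =>
    simp only [Sat, ih]
    constructor
    · intro h
      have hex : ∀ i, ∃ d, Sat (M i) (w i) (vcons d fun n => ρ n i) φ →
          ∀ d', Sat (M i) (w i) (vcons d' fun n => ρ n i) φ := by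
        intro i
        by_contra! hn
        obtain ⟨-, d, hd⟩ := hn (Classical.arbitrary _)
        exact hd (hn d).1
      choose d hd using hex
      filter_upwards [h d] with i hi
      exact hd i (vcons_apply d ρ i ▸ hi)
    · intro h d
      filter_upwards [h] with i hi
      exact vcons_apply d ρ i ▸ hi (d i)
  | ex φ ih =>
    simp only [Sat, ih]
    constructor
    · rintro ⟨d, h⟩
      filter_upwards [h] with i hi
      exact ⟨d i, vcons_apply d ρ i ▸ hi⟩
    · intro h
      have hex : ∀ i, ∃ d, (∃ d', Sat (M i) (w i) (vcons d' fun n => ρ n i) φ) →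
          Sat (M i) (w i) (vcons d fun n => ρ n i) φ := by
        intro i
        by_cases hi : ∃ d', Sat (M i) (w i) (vcons d' fun n => ρ n i) φ
        · exact hi.imp fun d hd _ => hd
        · exact ⟨Classical.arbitrary _, fun h' => absurd h' hi⟩
      choose d hd using hex
      refine ⟨d, ?_⟩
      filter_upwards [h] with i hi
      exact vcons_apply d ρ i ▸ hd i hi

end Ultraproduct

/-- **Compactness** (Theorem 2): if `Γ ⊨ φ` then `Γ₀ ⊨ φ` for some finite `Γ₀ ⊆ Γ`. -/
theorem compactness {L : Signature} (Γ : Set (Formula L)) (φ : Formula L)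
    (hΓ : ∀ ψ ∈ Γ, ψ.Sentence) (hφ : φ.Sentence)
    (h : Models.{u} Γ φ) :
    ∃ Γ₀ ⊆ Γ, Γ₀.Finite ∧ Models.{u} Γ₀ φ := by
  by_contra! hn
  have hex : ∀ s : Finset Γ, ∃ M : KModel.{u} L, M.Proper ∧ ∃ w : M.W, M.acc w w ∧
      (∀ ψ ∈ s, SatS M w ψ) ∧ ∃ ρ, ¬ Sat M w ρ φ := by
    intro s
    have hs := hn (Subtype.val '' (s : Set Γ)) (by simp) (s.finite_toSet.image _)
    simp only [Models, SatS] at hs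
    push Not at hs
    obtain ⟨M, hM, w, hw, hsat, hρ⟩ := hs
    exact ⟨M, hM, w, hw, fun ψ hψ => hsat ψ ⟨ψ, hψ, rfl⟩, hρ⟩
  choose M hM w hw hsat ρ hρ using hex
  let U : Ultrafilter (Finset Γ) := Ultrafilter.of Filter.atTop
  have hφU := h (KModel.ultraproduct U M) (.ultraproduct hM) w (.of_forall hw) (fun ψ hψ τ => by
    refine (sat_ultraproduct hM ψ _ _).mpr ?_
    have hmem : ∀ᶠ s in (U : Filter (Finset Γ)), {⟨ψ, hψ⟩} ≤ s :=
      Ultrafilter.of_le Filter.atTop (Filter.eventually_ge_atTop _)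
    filter_upwards [hmem] with s hs
    exact hsat s ⟨ψ, hψ⟩ (Finset.singleton_subset_iff.mp hs) _) fun n s => ρ s n
  obtain ⟨s, hs⟩ := ((sat_ultraproduct hM φ _ _).mp hφU).exists
  exact hρ s hs

end BQL
end

section
/- Unrestricted ∨-Elim: If (i) Γ ⊢ φ∨ψ, (ii) Γ ∪ {φ} ⊢ χ and (iii) Γ ∪ {ψ} ⊢ χ, then Γ ⊢ χ. -/
universe u v

namespace BQL

/-- `Prf L Γ Δ φ` formalizes `Γ : Δ ⊢ φ`: there is a proof of `φ` in the natural
deduction system `NBQL_CD^r` (over `L⁺`-sentences) whose open assumptions all belong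
to `Γ ∪ Δ` and in which every open assumption occurring *unsafely* (i.e. in the right
main subproof of an application of `→`-Elim) belongs to `Γ`.  Assumptions may be
discharged only at safe occurrences, so discharge always happens in the `Δ` zone. -/
inductive Prf (L : Signature) :
    Set (Formula L.plus) → Set (Formula L.plus) → Formula L.plus → Prop
  | hyp {Γ Δ : Set (Formula L.plus)} {φ} : φ ∈ Γ ∪ Δ → φ.Sentence → Prf L Γ Δ φ
  | weaken {Γ Γ' Δ Δ' φ} : Γ ⊆ Γ' → Δ ⊆ Δ' → Prf L Γ Δ φ → Prf L Γ' Δ' φ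
  | topIntro {Γ Δ} : Prf L Γ Δ .top
  | botElim {Γ Δ φ} : φ.Sentence → Prf L Γ Δ .bot → Prf L Γ Δ φ
  | andIntro {Γ Δ φ ψ} : Prf L Γ Δ φ → Prf L Γ Δ ψ → Prf L Γ Δ (.and φ ψ)
  | andElimL {Γ Δ φ ψ} : Prf L Γ Δ (.and φ ψ) → Prf L Γ Δ φ
  | andElimR {Γ Δ φ ψ} : Prf L Γ Δ (.and φ ψ) → Prf L Γ Δ ψ
  | orIntroL {Γ Δ φ ψ} : ψ.Sentence → Prf L Γ Δ φ → Prf L Γ Δ (.or φ ψ)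
  | orIntroR {Γ Δ φ ψ} : φ.Sentence → Prf L Γ Δ ψ → Prf L Γ Δ (.or φ ψ)
  | orElim {Γ Δ φ ψ χ} : Prf L Γ Δ (.or φ ψ) → Prf L Γ (insert φ Δ) χ →
      Prf L Γ (insert ψ Δ) χ → Prf L Γ Δ χ
  | impIntro {Γ Δ φ ψ} : φ.Sentence → Prf L Γ (insert φ Δ) ψ → Prf L Γ Δ (.imp φ ψ)
  | impElim {Γ Δ φ ψ} : Prf L Γ Δ φ → Prf L Γ ∅ (.imp φ ψ) → Prf L Γ Δ ψ
  | intTrans {Γ Δ φ ψ χ} : Prf L Γ Δ (.imp φ ψ) → Prf L Γ Δ (.imp ψ χ) →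
      Prf L Γ Δ (.imp φ χ)
  | intAndIntro {Γ Δ φ ψ χ} : Prf L Γ Δ (.imp φ ψ) → Prf L Γ Δ (.imp φ χ) →
      Prf L Γ Δ (.imp φ (.and ψ χ))
  | intOrElim {Γ Δ φ ψ χ} : Prf L Γ Δ (.imp φ χ) → Prf L Γ Δ (.imp ψ χ) →
      Prf L Γ Δ (.imp (.or φ ψ) χ)
  | intAllIntro {Γ Δ φ ψ} : φ.Sentence → Prf L Γ Δ (.all (.imp φ ψ)) →
      Prf L Γ Δ (.imp φ (.all ψ))
  | intExElim {Γ Δ φ ψ} : ψ.Sentence → Prf L Γ Δ (.all (.imp φ ψ)) →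
      Prf L Γ Δ (.imp (.ex φ) ψ)
  | allIntro {Γ Δ Γ' Δ' φ} {i : ℕ} : Γ' ⊆ Γ → Δ' ⊆ Δ → FreshIn i Γ' → FreshIn i Δ' →
      ¬ φ.OccC (Sum.inr i) → Prf L Γ' Δ' (subst0 φ (aconst L i)) → Prf L Γ Δ (.all φ)
  | allElim {Γ Δ φ} {t : Term L.plus} : t.Closed → Prf L Γ Δ (.all φ) →
      Prf L Γ Δ (subst0 φ t)
  | cd {Γ Δ φ ψ} : φ.Sentence → Prf L Γ Δ (.all (.or φ ψ)) → Prf L Γ Δ (.or φ (.all ψ))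
  | exIntro {Γ Δ φ} {t : Term L.plus} : t.Closed → (Formula.ex φ).Sentence →
      Prf L Γ Δ (subst0 φ t) → Prf L Γ Δ (.ex φ)
  | exElim {Γ Δ Γ' Δ' φ ψ} {i : ℕ} : Γ' ⊆ Γ → Δ' ⊆ Δ → FreshIn i Γ' → FreshIn i Δ' →
      ¬ φ.OccC (Sum.inr i) → ¬ ψ.OccC (Sum.inr i) → Prf L Γ Δ (.ex φ) →
      Prf L Γ' (insert (subst0 φ (aconst L i)) Δ') ψ → Prf L Γ Δ ψ

/-- `Γ ⊢ φ`: there is a proof of `φ` from `Γ` in `NBQL_CD^r`. -/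
def Prv (L : Signature) (Γ : Set (Formula L.plus)) (φ : Formula L.plus) : Prop :=
  Prf L Γ ∅ φ

end BQL

namespace BQL

section Substitution

variable {L : Signature}

theorem Term.closedAt_shiftUp {t : Term L} {k : ℕ} :
    t.shiftUp.ClosedAt (k + 1) ↔ t.ClosedAt k := by
  induction t with
  | var n => simp [shiftUp, ClosedAt]
  | const c => simp [shiftUp, ClosedAt]
  | func f ts ih => simp [shiftUp, ClosedAt, ih]

theorem Term.ClosedAt.applySub {t : Term L} {σ : ℕ → Term L} {k m : ℕ}
    (hσ : ∀ n < k, (σ n).ClosedAt m) (ht : t.ClosedAt k) : (t.applySub σ).ClosedAt m := by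
  induction t with
  | var n => exact hσ n ht
  | const c => trivial
  | func f ts ih => exact fun i => ih i (ht i)

theorem liftSub_closedAt {σ : ℕ → Term L} {k m : ℕ} (hσ : ∀ n < k, (σ n).ClosedAt m) :
    ∀ n < k + 1, (liftSub σ n).ClosedAt (m + 1)
  | 0, _ => Nat.succ_pos m
  | n + 1, h => Term.closedAt_shiftUp.2 (hσ n (Nat.lt_of_succ_lt_succ h))

theorem Formula.ClosedAt.applySub {φ : Formula L} {σ : ℕ → Term L} {k m : ℕ}
    (hσ : ∀ n < k, (σ n).ClosedAt m) (h : φ.ClosedAt k) : (φ.applySub σ).ClosedAt m := by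
  induction φ generalizing σ k m with
  | top => trivial
  | bot => trivial
  | rel R ts => exact fun i => (h i).applySub hσ
  | and φ ψ ih₁ ih₂ => exact ⟨ih₁ hσ h.1, ih₂ hσ h.2⟩
  | or φ ψ ih₁ ih₂ => exact ⟨ih₁ hσ h.1, ih₂ hσ h.2⟩
  | imp φ ψ ih₁ ih₂ => exact ⟨ih₁ hσ h.1, ih₂ hσ h.2⟩
  | all φ ih => exact ih (liftSub_closedAt hσ) h
  | ex φ ih => exact ih (liftSub_closedAt hσ) h

theorem Term.ClosedAt.of_applySub {t : Term L} {σ : ℕ → Term L} {k m : ℕ}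
    (hσ : ∀ n, (σ n).ClosedAt m → n < k) (ht : (t.applySub σ).ClosedAt m) : t.ClosedAt k := by
  induction t with
  | var n => exact hσ n ht
  | const c => trivial
  | func f ts ih => exact fun i => ih i (ht i)

theorem lt_of_liftSub_closedAt {σ : ℕ → Term L} {k m : ℕ} (hσ : ∀ n, (σ n).ClosedAt m → n < k) :
    ∀ n, (liftSub σ n).ClosedAt (m + 1) → n < k + 1
  | 0, _ => Nat.succ_pos k
  | n + 1, h => Nat.succ_lt_succ (hσ n (Term.closedAt_shiftUp.1 h))

theorem Formula.ClosedAt.of_applySub {φ : Formula L} {σ : ℕ → Term L} {k m : ℕ}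
    (hσ : ∀ n, (σ n).ClosedAt m → n < k) (h : (φ.applySub σ).ClosedAt m) : φ.ClosedAt k := by
  induction φ generalizing σ k m with
  | top => trivial
  | bot => trivial
  | rel R ts => exact fun i => (h i).of_applySub hσ
  | and φ ψ ih₁ ih₂ => exact ⟨ih₁ hσ h.1, ih₂ hσ h.2⟩
  | or φ ψ ih₁ ih₂ => exact ⟨ih₁ hσ h.1, ih₂ hσ h.2⟩
  | imp φ ψ ih₁ ih₂ => exact ⟨ih₁ hσ h.1, ih₂ hσ h.2⟩
  | all φ ih => exact ih (lt_of_liftSub_closedAt hσ) h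
  | ex φ ih => exact ih (lt_of_liftSub_closedAt hσ) h

theorem Term.ClosedAt.applySub_eq {t : Term L} {σ : ℕ → Term L} {k : ℕ}
    (hσ : ∀ n < k, σ n = .var n) (ht : t.ClosedAt k) : t.applySub σ = t := by
  induction t with
  | var n => exact hσ n ht
  | const c => rfl
  | func f ts ih => exact congrArg (func f) (funext fun i => ih i (ht i))

theorem liftSub_eq_var {σ : ℕ → Term L} {k : ℕ} (hσ : ∀ n < k, σ n = .var n) :
    ∀ n < k + 1, liftSub σ n = .var n
  | 0, _ => rfl
  | n + 1, h => by rw [liftSub, hσ n (Nat.lt_of_succ_lt_succ h)]; rfl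

theorem Formula.ClosedAt.applySub_eq {φ : Formula L} {σ : ℕ → Term L} {k : ℕ}
    (hσ : ∀ n < k, σ n = .var n) (h : φ.ClosedAt k) : φ.applySub σ = φ := by
  induction φ generalizing σ k with
  | top => rfl
  | bot => rfl
  | rel R ts => exact congrArg (rel R) (funext fun i => (h i).applySub_eq hσ)
  | and φ ψ ih₁ ih₂ => exact congrArg₂ and (ih₁ hσ h.1) (ih₂ hσ h.2)
  | or φ ψ ih₁ ih₂ => exact congrArg₂ or (ih₁ hσ h.1) (ih₂ hσ h.2)
  | imp φ ψ ih₁ ih₂ => exact congrArg₂ imp (ih₁ hσ h.1) (ih₂ hσ h.2)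
  | all φ ih => exact congrArg all (ih (liftSub_eq_var hσ) h)
  | ex φ ih => exact congrArg ex (ih (liftSub_eq_var hσ) h)

theorem sentence_subst0 {φ : Formula L} {t : Term L} (h : φ.ClosedAt 1) (ht : t.Closed) :
    (subst0 φ t).Sentence := by
  refine Formula.ClosedAt.applySub (fun n hn => ?_) h
  obtain rfl : n = 0 := by omega
  exact ht

theorem closedAt_one_of_subst0 {φ : Formula L} {t : Term L} (h : (subst0 φ t).Sentence) :
    φ.ClosedAt 1 := by
  refine Formula.ClosedAt.of_applySub (fun n hn => ?_) h
  cases n with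
  | zero => exact Nat.one_pos
  | succ n => exact absurd hn (Nat.not_lt_zero n)

theorem Formula.Sentence.subst0_eq {φ : Formula L} (h : φ.Sentence) (t : Term L) :
    subst0 φ t = φ :=
  Formula.ClosedAt.applySub_eq (fun n hn => absurd hn (Nat.not_lt_zero n)) h

theorem Term.ClosedAt.mono {t : Term L} {k m : ℕ} (hkm : k ≤ m) (h : t.ClosedAt k) :
    t.ClosedAt m := by
  induction t with
  | var n => exact lt_of_lt_of_le h hkm
  | const c => trivial
  | func f ts ih => exact fun i => ih i (h i)

theorem Formula.ClosedAt.mono {φ : Formula L} {k m : ℕ} (hkm : k ≤ m) (h : φ.ClosedAt k) :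
    φ.ClosedAt m := by
  induction φ generalizing k m with
  | top => trivial
  | bot => trivial
  | rel R ts => exact fun i => (h i).mono hkm
  | and φ ψ ih₁ ih₂ => exact ⟨ih₁ hkm h.1, ih₂ hkm h.2⟩
  | or φ ψ ih₁ ih₂ => exact ⟨ih₁ hkm h.1, ih₂ hkm h.2⟩
  | imp φ ψ ih₁ ih₂ => exact ⟨ih₁ hkm h.1, ih₂ hkm h.2⟩
  | all φ ih => exact ih (Nat.succ_le_succ hkm) h
  | ex φ ih => exact ih (Nat.succ_le_succ hkm) h

end Substitution

section Renaming

variable {L : Signature}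

/-- Rename the constants of a term along `g`. -/
def Term.mapConst (g : L.Const → L.Const) : Term L → Term L
  | var n => var n
  | const c => const (g c)
  | func f ts => func f fun i => (ts i).mapConst g

/-- Rename the constants of a formula along `g`. -/
def Formula.mapConst (g : L.Const → L.Const) : Formula L → Formula L
  | top => top
  | bot => bot
  | rel R ts => rel R fun i => (ts i).mapConst g
  | and φ ψ => and (φ.mapConst g) (ψ.mapConst g)
  | or φ ψ => or (φ.mapConst g) (ψ.mapConst g)
  | imp φ ψ => imp (φ.mapConst g) (ψ.mapConst g)
  | all φ => all (φ.mapConst g)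
  | ex φ => ex (φ.mapConst g)

theorem Term.closedAt_mapConst {g : L.Const → L.Const} {t : Term L} {k : ℕ} :
    (t.mapConst g).ClosedAt k ↔ t.ClosedAt k := by
  induction t with
  | var n => rfl
  | const c => rfl
  | func f ts ih => simp [mapConst, ClosedAt, ih]

theorem Formula.closedAt_mapConst {g : L.Const → L.Const} {φ : Formula L} {k : ℕ} :
    (φ.mapConst g).ClosedAt k ↔ φ.ClosedAt k := by
  induction φ generalizing k <;> simp [mapConst, ClosedAt, Term.closedAt_mapConst, *]

theorem Formula.Sentence.mapConst {φ : Formula L} (h : φ.Sentence) (g : L.Const → L.Const) :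
    (φ.mapConst g).Sentence :=
  closedAt_mapConst.2 h

theorem Term.mapConst_id (t : Term L) : t.mapConst id = t := by
  induction t with
  | var n => rfl
  | const c => rfl
  | func f ts ih => exact congrArg (func f) (funext ih)

theorem Formula.mapConst_id (φ : Formula L) : φ.mapConst id = φ := by
  induction φ <;> simp [mapConst, Term.mapConst_id, *]

theorem Term.mapConst_congr {g g' : L.Const → L.Const} {t : Term L}
    (h : ∀ c, t.OccC c → g c = g' c) : t.mapConst g = t.mapConst g' := by
  induction t with
  | var n => rfl
  | const c => exact congrArg const (h c rfl)
  | func f ts ih => exact congrArg (func f) (funext fun i => ih i fun c hc => h c ⟨i, hc⟩)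

theorem Formula.mapConst_congr {g g' : L.Const → L.Const} {φ : Formula L}
    (h : ∀ c, φ.OccC c → g c = g' c) : φ.mapConst g = φ.mapConst g' := by
  induction φ with
  | top => rfl
  | bot => rfl
  | rel R ts =>
    exact congrArg (rel R) (funext fun i => Term.mapConst_congr fun c hc => h c ⟨i, hc⟩)
  | and φ ψ ih₁ ih₂ =>
    exact congrArg₂ and (ih₁ fun c hc => h c (.inl hc)) (ih₂ fun c hc => h c (.inr hc))
  | or φ ψ ih₁ ih₂ =>
    exact congrArg₂ or (ih₁ fun c hc => h c (.inl hc)) (ih₂ fun c hc => h c (.inr hc))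
  | imp φ ψ ih₁ ih₂ =>
    exact congrArg₂ imp (ih₁ fun c hc => h c (.inl hc)) (ih₂ fun c hc => h c (.inr hc))
  | all φ ih => exact congrArg all (ih h)
  | ex φ ih => exact congrArg ex (ih h)

open Classical in
theorem Formula.mapConst_update {g : L.Const → L.Const} {φ : Formula L} {c d : L.Const}
    (h : ¬ φ.OccC c) : φ.mapConst (Function.update g c d) = φ.mapConst g :=
  mapConst_congr fun e he => Function.update_of_ne (fun hec : e = c => h (by rwa [← hec])) d g

theorem Term.mapConst_shiftUp (g : L.Const → L.Const) (t : Term L) :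
    t.shiftUp.mapConst g = (t.mapConst g).shiftUp := by
  induction t with
  | var n => rfl
  | const c => rfl
  | func f ts ih => exact congrArg (func f) (funext ih)

theorem Term.mapConst_applySub (g : L.Const → L.Const) (σ : ℕ → Term L) (t : Term L) :
    (t.applySub σ).mapConst g = (t.mapConst g).applySub fun n => (σ n).mapConst g := by
  induction t with
  | var n => rfl
  | const c => rfl
  | func f ts ih => exact congrArg (func f) (funext ih)

theorem liftSub_mapConst (g : L.Const → L.Const) (σ : ℕ → Term L) :
    (fun n => (liftSub σ n).mapConst g) = liftSub fun n => (σ n).mapConst g := by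
  funext n
  cases n with
  | zero => rfl
  | succ n => exact Term.mapConst_shiftUp g (σ n)

theorem Formula.mapConst_applySub (g : L.Const → L.Const) (σ : ℕ → Term L) (φ : Formula L) :
    (φ.applySub σ).mapConst g = (φ.mapConst g).applySub fun n => (σ n).mapConst g := by
  induction φ generalizing σ <;>
    simp [mapConst, applySub, Term.mapConst_applySub, liftSub_mapConst, *]

theorem mapConst_subst0 (g : L.Const → L.Const) (φ : Formula L) (t : Term L) :
    (subst0 φ t).mapConst g = subst0 (φ.mapConst g) (t.mapConst g) := by
  rw [subst0, Formula.mapConst_applySub, subst0]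
  congr 1
  funext n
  cases n <;> rfl

/-- The name of the fresh constant `aᵢ`. -/
abbrev aname (L : Signature) (i : ℕ) : L.plus.Const := Sum.inr i

open Classical in
theorem mapConst_update_subst0_aconst {g : L.plus.Const → L.plus.Const} {φ : Formula L.plus}
    {i j : ℕ} (h : ¬ φ.OccC (aname L i)) :
    (subst0 φ (aconst L i)).mapConst (Function.update g (aname L i) (aname L j)) =
      subst0 (φ.mapConst g) (aconst L j) := by
  rw [mapConst_subst0, Formula.mapConst_update h]
  exact congrArg (fun c => subst0 (φ.mapConst g) (.const c))
    (Function.update_self (aname L i) (aname L j) g)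

end Renaming

section Fresh

open Filter

variable {L : Signature}

theorem Term.eventually_not_occC (t : Term L.plus) :
    ∀ᶠ j : ℕ in atTop, ¬ t.OccC (Sum.inr j) := by
  induction t with
  | var n => exact Eventually.of_forall fun _ h => h
  | const c =>
    rcases c with c | n
    · exact Eventually.of_forall fun _ h => Sum.inl_ne_inr h
    · exact (eventually_gt_atTop n).mono fun j hj h => hj.ne (Sum.inr.inj h)
  | func f ts ih =>
    exact (eventually_all (ι := Fin (L.arityF f)).2 ih).mono fun j hj ⟨i, hi⟩ => hj i hi

theorem Formula.eventually_not_occC (φ : Formula L.plus) :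
    ∀ᶠ j : ℕ in atTop, ¬ φ.OccC (Sum.inr j) := by
  induction φ with
  | top => exact Eventually.of_forall fun _ h => h
  | bot => exact Eventually.of_forall fun _ h => h
  | rel R ts =>
    exact (eventually_all (ι := Fin (L.arityR R)).2 fun i => (ts i).eventually_not_occC).mono
      fun j hj ⟨i, hi⟩ => hj i hi
  | and φ ψ ih₁ ih₂ => exact (ih₁.and ih₂).mono fun j hj h => h.elim hj.1 hj.2
  | or φ ψ ih₁ ih₂ => exact (ih₁.and ih₂).mono fun j hj h => h.elim hj.1 hj.2
  | imp φ ψ ih₁ ih₂ => exact (ih₁.and ih₂).mono fun j hj h => h.elim hj.1 hj.2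
  | all φ ih => exact ih
  | ex φ ih => exact ih

theorem eventually_freshIn {Γ : Set (Formula L.plus)} (hΓ : Γ.Finite) :
    ∀ᶠ j : ℕ in atTop, FreshIn j Γ :=
  (eventually_all_finite hΓ).2 fun φ _ => φ.eventually_not_occC

end Fresh

section Derivations

variable {L : Signature} {Γ Δ : Set (Formula L.plus)} {θ E φ ψ χ : Formula L.plus}

theorem Prf.sentence (h : Prf L Γ Δ φ) : φ.Sentence := by
  induction h with
  | hyp _ h => exact h
  | weaken _ _ _ ih => exact ih
  | topIntro => trivial
  | botElim h _ _ => exact h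
  | andIntro _ _ ih₁ ih₂ => exact ⟨ih₁, ih₂⟩
  | andElimL _ ih => exact ih.1
  | andElimR _ ih => exact ih.2
  | orIntroL h _ ih => exact ⟨ih, h⟩
  | orIntroR h _ ih => exact ⟨h, ih⟩
  | orElim _ _ _ _ ih _ => exact ih
  | impIntro h _ ih => exact ⟨h, ih⟩
  | impElim _ _ _ ih => exact ih.2
  | intTrans _ _ ih₁ ih₂ => exact ⟨ih₁.1, ih₂.2⟩
  | intAndIntro _ _ ih₁ ih₂ => exact ⟨ih₁.1, ih₁.2, ih₂.2⟩
  | intOrElim _ _ ih₁ ih₂ => exact ⟨⟨ih₁.1, ih₂.1⟩, ih₁.2⟩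
  | intAllIntro h _ ih => exact ⟨h, ih.2⟩
  | intExElim h _ ih => exact ⟨ih.1, h⟩
  | allIntro _ _ _ _ _ _ ih => exact closedAt_one_of_subst0 ih
  | allElim ht _ ih => exact sentence_subst0 ih ht
  | cd h _ ih => exact ⟨h, ih.2⟩
  | exIntro _ h _ _ => exact h
  | exElim _ _ _ _ _ _ _ _ _ ih => exact ih

theorem exists_finite_of_subset_insert {α : Type*} {D Δ : Set α} {a : α} (hD : D.Finite)
    (h : D ⊆ insert a Δ) : ∃ D' ⊆ Δ, D'.Finite ∧ D ⊆ insert a D' :=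
  ⟨D \ {a}, by simpa using h, hD.sdiff, by simp⟩

/-- Every proof uses only finitely many assumptions. -/
theorem Prf.exists_finite (h : Prf L Γ Δ φ) :
    ∃ G ⊆ Γ, ∃ D ⊆ Δ, G.Finite ∧ D.Finite ∧ Prf L G D φ := by
  have unary : ∀ {Γ Δ : Set (Formula L.plus)} {α β : Formula L.plus},
      (∃ G ⊆ Γ, ∃ D ⊆ Δ, G.Finite ∧ D.Finite ∧ Prf L G D α) →
      (∀ {G D}, Prf L G D α → Prf L G D β) →
      ∃ G ⊆ Γ, ∃ D ⊆ Δ, G.Finite ∧ D.Finite ∧ Prf L G D β := by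
    rintro Γ Δ α β ⟨G, hG, D, hD, fG, fD, h⟩ k
    exact ⟨G, hG, D, hD, fG, fD, k h⟩
  have binary : ∀ {Γ Δ : Set (Formula L.plus)} {α β γ : Formula L.plus},
      (∃ G ⊆ Γ, ∃ D ⊆ Δ, G.Finite ∧ D.Finite ∧ Prf L G D α) →
      (∃ G ⊆ Γ, ∃ D ⊆ Δ, G.Finite ∧ D.Finite ∧ Prf L G D β) →
      (∀ {G D}, Prf L G D α → Prf L G D β → Prf L G D γ) →
      ∃ G ⊆ Γ, ∃ D ⊆ Δ, G.Finite ∧ D.Finite ∧ Prf L G D γ := by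
    rintro Γ Δ α β γ ⟨G, hG, D, hD, fG, fD, h⟩ ⟨G', hG', D', hD', fG', fD', h'⟩ k
    exact ⟨G ∪ G', Set.union_subset hG hG', D ∪ D', Set.union_subset hD hD', fG.union fG',
      fD.union fD', k (.weaken Set.subset_union_left Set.subset_union_left h)
        (.weaken Set.subset_union_right Set.subset_union_right h')⟩
  induction h with
  | @hyp Γ Δ φ hmem hs =>
    rcases hmem with hmem | hmem
    · exact ⟨{φ}, by simpa using hmem, ∅, by simp, by simp, by simp, .hyp (by simp) hs⟩
    · exact ⟨∅, by simp, {φ}, by simpa using hmem, by simp, by simp, .hyp (by simp) hs⟩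
  | weaken hΓ hΔ _ ih =>
    obtain ⟨G, hG, D, hD, h⟩ := ih
    exact ⟨G, hG.trans hΓ, D, hD.trans hΔ, h⟩
  | topIntro => exact ⟨∅, by simp, ∅, by simp, by simp, by simp, .topIntro⟩
  | botElim hs _ ih => exact unary ih (.botElim hs)
  | andIntro _ _ ih₁ ih₂ => exact binary ih₁ ih₂ .andIntro
  | andElimL _ ih => exact unary ih .andElimL
  | andElimR _ ih => exact unary ih .andElimR
  | orIntroL hs _ ih => exact unary ih (.orIntroL hs)
  | orIntroR hs _ ih => exact unary ih (.orIntroR hs)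
  | orElim _ _ _ ih₁ ih₂ ih₃ =>
    obtain ⟨G₁, hG₁, D₁, hD₁, fG₁, fD₁, h₁⟩ := ih₁
    obtain ⟨G₂, hG₂, D₂, hD₂, fG₂, fD₂, h₂⟩ := ih₂
    obtain ⟨G₃, hG₃, D₃, hD₃, fG₃, fD₃, h₃⟩ := ih₃
    obtain ⟨D₂', hD₂', fD₂', hs₂⟩ := exists_finite_of_subset_insert fD₂ hD₂
    obtain ⟨D₃', hD₃', fD₃', hs₃⟩ := exists_finite_of_subset_insert fD₃ hD₃
    refine ⟨G₁ ∪ (G₂ ∪ G₃), by simp [*], D₁ ∪ (D₂' ∪ D₃'), by simp [*],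
      fG₁.union (fG₂.union fG₃), fD₁.union (fD₂'.union fD₃'), .orElim (.weaken ?_ ?_ h₁)
      (.weaken ?_ (hs₂.trans (Set.insert_subset_insert ?_)) h₂)
      (.weaken ?_ (hs₃.trans (Set.insert_subset_insert ?_)) h₃)⟩ <;> grind
  | impIntro hs _ ih =>
    obtain ⟨G, hG, D, hD, fG, fD, h⟩ := ih
    obtain ⟨D', hD', fD', hsub⟩ := exists_finite_of_subset_insert fD hD
    exact ⟨G, hG, D', hD', fG, fD', .impIntro hs (.weaken subset_rfl hsub h)⟩
  | impElim _ _ ih₁ ih₂ =>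
    obtain ⟨G₁, hG₁, D₁, hD₁, fG₁, fD₁, h₁⟩ := ih₁
    obtain ⟨G₂, hG₂, D₂, hD₂, fG₂, -, h₂⟩ := ih₂
    exact ⟨G₁ ∪ G₂, Set.union_subset hG₁ hG₂, D₁, hD₁, fG₁.union fG₂, fD₁,
      .impElim (.weaken Set.subset_union_left subset_rfl h₁)
        (.weaken Set.subset_union_right hD₂ h₂)⟩
  | intTrans _ _ ih₁ ih₂ => exact binary ih₁ ih₂ .intTrans
  | intAndIntro _ _ ih₁ ih₂ => exact binary ih₁ ih₂ .intAndIntro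
  | intOrElim _ _ ih₁ ih₂ => exact binary ih₁ ih₂ .intOrElim
  | intAllIntro hs _ ih => exact unary ih (.intAllIntro hs)
  | intExElim hs _ ih => exact unary ih (.intExElim hs)
  | allIntro hΓ hΔ fΓ fΔ hφ _ ih =>
    obtain ⟨G, hG, D, hD, fG, fD, h⟩ := ih
    exact ⟨G, hG.trans hΓ, D, hD.trans hΔ, fG, fD, .allIntro subset_rfl subset_rfl
      (fun γ hγ => fΓ γ (hG hγ)) (fun γ hγ => fΔ γ (hD hγ)) hφ h⟩
  | allElim ht _ ih => exact unary ih (.allElim ht)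
  | cd hs _ ih => exact unary ih (.cd hs)
  | exIntro ht hs _ ih => exact unary ih (.exIntro ht hs)
  | exElim hΓ hΔ fΓ fΔ hφ hψ _ _ ih₁ ih₂ =>
    obtain ⟨G₁, hG₁, D₁, hD₁, fG₁, fD₁, h₁⟩ := ih₁
    obtain ⟨G₂, hG₂, D₂, hD₂, fG₂, fD₂, h₂⟩ := ih₂
    obtain ⟨D₂', hD₂', fD₂', hs₂⟩ := exists_finite_of_subset_insert fD₂ hD₂
    exact ⟨G₁ ∪ G₂, Set.union_subset hG₁ (hG₂.trans hΓ), D₁ ∪ D₂',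
      Set.union_subset hD₁ (hD₂'.trans hΔ), fG₁.union fG₂, fD₁.union fD₂',
      .exElim Set.subset_union_right Set.subset_union_right
        (fun γ hγ => fΓ γ (hG₂ hγ)) (fun γ hγ => fΔ γ (hD₂' hγ)) hφ hψ
        (.weaken Set.subset_union_left Set.subset_union_left h₁) (.weaken subset_rfl hs₂ h₂)⟩

theorem Prf.self (h : φ.Sentence) : Prf L Γ {φ} φ :=
  .hyp (by simp) h

theorem Prf.imp_of_singleton (hφ : φ.Sentence) (h : Prf L Γ {φ} ψ) : Prf L Γ Δ (.imp φ ψ) :=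
  .impIntro hφ (.weaken subset_rfl (by simp) h)

theorem Prf.imp_self (hφ : φ.Sentence) : Prf L Γ Δ (.imp φ φ) :=
  imp_of_singleton hφ (self hφ)

theorem Prf.or_map (h : Prf L Γ ∅ (.or θ φ)) (k : Prf L Γ {φ} ψ) : Prf L Γ ∅ (.or θ ψ) :=
  .orElim h (.orIntroL k.sentence (.hyp (by simp) h.sentence.1))
    (.orIntroR h.sentence.1 (.weaken subset_rfl (by simp) k))

theorem Prf.or_map₂ (h₁ : Prf L Γ ∅ (.or θ φ)) (h₂ : Prf L Γ ∅ (.or θ ψ))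
    (k : Prf L Γ {φ, ψ} χ) : Prf L Γ ∅ (.or θ χ) :=
  .orElim h₁ (.orIntroL k.sentence (.hyp (by simp) h₁.sentence.1)) <|
    .orElim (.weaken subset_rfl (by simp) h₂)
      (.orIntroL k.sentence (.hyp (by simp) h₁.sentence.1))
      (.orIntroR h₁.sentence.1 (.weaken subset_rfl (by grind) k))

theorem Prf.or_imp_map (h : Prf L Γ ∅ (.or θ (.imp E φ))) (k : Prf L Γ {φ} ψ) :
    Prf L Γ ∅ (.or θ (.imp E ψ)) :=
  h.or_map (.intTrans (self h.sentence.2) (imp_of_singleton h.sentence.2.2 k))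

theorem Prf.or_imp_and (h₁ : Prf L Γ ∅ (.or θ (.imp E φ))) (h₂ : Prf L Γ ∅ (.or θ (.imp E ψ))) :
    Prf L Γ ∅ (.or θ (.imp E (.and φ ψ))) :=
  h₁.or_map₂ h₂ (.intAndIntro (.hyp (by simp) h₁.sentence.2) (.hyp (by simp) h₂.sentence.2))

/-- Without safe assumptions, `⊤ → φ` may be detached under a disjunction. -/
theorem Prf.or_of_or_box (h : Prf L Γ ∅ (.or θ (.imp .top φ))) : Prf L Γ ∅ (.or θ φ) := by
  have hθ := h.sentence.1
  have hφ : φ.Sentence := h.sentence.2.2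
  refine .impElim .topIntro (.orElim h ?_ ?_)
  · exact .impIntro trivial (.orIntroL hφ (.hyp (by simp) hθ))
  · exact .intTrans (.hyp (by simp) h.sentence.2)
      (imp_of_singleton hφ (.orIntroR hθ (self hφ)))

theorem Prf.or_imp_or_elim (h : Prf L Γ ∅ (.or θ (.imp E (.or φ ψ))))
    (hφ : Prf L Γ ∅ (.or θ (.imp (.and E φ) χ))) (hψ : Prf L Γ ∅ (.or θ (.imp (.and E ψ) χ))) :
    Prf L Γ ∅ (.or θ (.imp E χ)) := by
  have hE : E.Sentence := h.sentence.2.1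
  have sφ : φ.Sentence := h.sentence.2.2.1
  have sψ : ψ.Sentence := h.sentence.2.2.2
  have distrib : Prf L Γ {.and E (.or φ ψ)} (.or (.and E φ) (.and E ψ)) := by
    have hyp : ∀ α, Prf L Γ (insert α {.and E (.or φ ψ)}) (.and E (.or φ ψ)) := fun α =>
      .hyp (by simp) ⟨hE, sφ, sψ⟩
    exact .orElim (.andElimR (φ := E) (self ⟨hE, sφ, sψ⟩))
      (.orIntroL ⟨hE, sψ⟩ (.andIntro (.andElimL (hyp φ)) (.hyp (by simp) sφ)))
      (.orIntroR ⟨hE, sφ⟩ (.andIntro (.andElimL (hyp ψ)) (.hyp (by simp) sψ)))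
  have hEE : Prf L Γ ∅ (.or θ (.imp E E)) := .orIntroR h.sentence.1 (imp_self hE)
  have hcase : Prf L Γ ∅ (.or θ (.imp (.or (.and E φ) (.and E ψ)) χ)) :=
    hφ.or_map₂ hψ (.intOrElim (.hyp (by simp) hφ.sentence.2) (.hyp (by simp) hψ.sentence.2))
  exact ((hEE.or_imp_and h).or_imp_map distrib).or_map₂ hcase
    (.intTrans (φ := E) (ψ := .or (.and E φ) (.and E ψ))
      (.hyp (by simp) ⟨hE, ⟨hE, sφ⟩, hE, sψ⟩) (.hyp (by simp) hcase.sentence.2))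

theorem Prf.or_imp_curry (h : Prf L Γ ∅ (.or θ (.imp (.and E φ) ψ))) :
    Prf L Γ ∅ (.or θ (.imp E (.imp φ ψ))) := by
  have hE : E.Sentence := h.sentence.2.1.1
  have hφ : φ.Sentence := h.sentence.2.1.2
  refine h.or_map (.impIntro hE (.intTrans (ψ := .and E φ) (.impIntro hφ ?_) ?_))
  · exact .andIntro (.hyp (by simp) hE) (.hyp (by simp) hφ)
  · exact .hyp (by simp) h.sentence.2

theorem Prf.or_all_of_fresh {i : ℕ} (hΓ : FreshIn i Γ) (hθ : ¬ θ.OccC (Sum.inr i))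
    (hφ : ¬ φ.OccC (Sum.inr i)) (h : Prf L Γ ∅ (.or θ (subst0 φ (aconst L i)))) :
    Prf L Γ ∅ (.or θ (.all φ)) := by
  have sθ : θ.Sentence := h.sentence.1
  refine .cd sθ (.allIntro (i := i) subset_rfl subset_rfl hΓ (by simp [FreshIn]) (by
    simp [Formula.OccC, hθ, hφ]) ?_)
  change Prf L Γ ∅ (.or (subst0 θ _) (subst0 φ _))
  rwa [sθ.subst0_eq]

theorem Prf.or_imp_all_of_fresh {i : ℕ} (hΓ : FreshIn i Γ) (hθ : ¬ θ.OccC (Sum.inr i))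
    (hE : ¬ E.OccC (Sum.inr i)) (hφ : ¬ φ.OccC (Sum.inr i))
    (h : Prf L Γ ∅ (.or θ (.imp E (subst0 φ (aconst L i))))) :
    Prf L Γ ∅ (.or θ (.imp E (.all φ))) := by
  have sE : E.Sentence := h.sentence.2.1
  have key : Prf L Γ ∅ (.or θ (.all (.imp E φ))) := by
    refine .or_all_of_fresh hΓ hθ (by simp [Formula.OccC, hE, hφ]) ?_
    change Prf L Γ ∅ (.or θ (.imp (subst0 E _) (subst0 φ _)))
    rwa [sE.subst0_eq]
  exact key.or_map (.intAllIntro sE (self key.sentence.2))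

theorem Prf.ex_and_of_and_ex (hE : E.Sentence) (hφ : (Formula.ex φ).Sentence) :
    Prf L Γ {.and E (.ex φ)} (.ex (.and E φ)) := by
  obtain ⟨k, kE, kφ⟩ := (E.eventually_not_occC.and φ.eventually_not_occC).exists
  have sk : (subst0 φ (aconst L k)).Sentence := sentence_subst0 hφ trivial
  refine .exElim (Γ' := ∅) (i := k) (Set.empty_subset _) subset_rfl (by simp [FreshIn])
    (by simp [FreshIn, Formula.OccC, kE, kφ]) kφ (by simp [Formula.OccC, kE, kφ])
    (.andElimR (self ⟨hE, hφ⟩)) ?_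
  refine .exIntro (t := aconst L k) trivial ⟨hE.mono (Nat.zero_le 1), hφ⟩ ?_
  change Prf L _ _ (.and (subst0 E _) (subst0 φ _))
  rw [hE.subst0_eq]
  exact .andIntro (.andElimL (.hyp (by simp) ⟨hE, hφ⟩)) (.hyp (by simp) sk)

theorem Prf.or_imp_ex_elim_of_fresh {i : ℕ} (hΓ : FreshIn i Γ) (hθ : ¬ θ.OccC (Sum.inr i))
    (hE : ¬ E.OccC (Sum.inr i)) (hφ : ¬ φ.OccC (Sum.inr i)) (hψ : ¬ ψ.OccC (Sum.inr i))
    (h₁ : Prf L Γ ∅ (.or θ (.imp E (.ex φ))))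
    (h₂ : Prf L Γ ∅ (.or θ (.imp (.and E (subst0 φ (aconst L i))) ψ))) :
    Prf L Γ ∅ (.or θ (.imp E ψ)) := by
  have sE : E.Sentence := h₁.sentence.2.1
  have sψ : ψ.Sentence := h₂.sentence.2.2
  have hall : Prf L Γ ∅ (.or θ (.all (.imp (.and E φ) ψ))) := by
    refine .or_all_of_fresh hΓ hθ (by simp [Formula.OccC, hE, hφ, hψ]) ?_
    change Prf L Γ ∅ (.or θ (.imp (.and (subst0 E _) (subst0 φ _)) (subst0 ψ _)))
    rwa [sE.subst0_eq, sψ.subst0_eq]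
  have hex := hall.or_map (.intExElim sψ (self hall.sentence.2))
  have hEE : Prf L Γ ∅ (.or θ (.imp E E)) := .orIntroR h₁.sentence.1 (imp_self sE)
  have hand := (hEE.or_imp_and h₁).or_imp_map (ex_and_of_and_ex sE h₁.sentence.2.2)
  exact hand.or_map₂ hex
    (.intTrans (.hyp (by simp) hand.sentence.2) (.hyp (by simp) hex.sentence.2))

open Classical in
/-- A proof from unsafe assumptions `Γ` and safe assumptions `Δ` can be carried out under a
disjunction with `θ` and an implication from `E`, even after renaming constants: the renaming
allows eigenconstants to be kept apart from `θ` and `E`. -/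
theorem Prf.or_imp_of_relativized (h : Prf L Γ Δ χ) {G : Set (Formula L.plus)} (hG : G.Finite)
    (g : L.plus.Const → L.plus.Const) (hθ : θ.Sentence) (hE : E.Sentence)
    (hΓ : ∀ γ ∈ Γ, γ.Sentence → Prf L G ∅ (.or θ (γ.mapConst g)))
    (hΔ : ∀ δ ∈ Δ, δ.Sentence → Prf L G ∅ (.imp E (δ.mapConst g))) :
    Prf L G ∅ (.or θ (.imp E (χ.mapConst g))) := by
  have extend : ∀ {G Δ : Set (Formula L.plus)} {E β : Formula L.plus}
      {g : L.plus.Const → L.plus.Const} (α : Formula L.plus), E.Sentence → β.Sentence →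
      α.mapConst g = β →
      (∀ δ ∈ Δ, δ.Sentence → Prf L G ∅ (.imp E (δ.mapConst g))) →
      ∀ δ ∈ insert α Δ, δ.Sentence → Prf L G ∅ (.imp (.and E β) (δ.mapConst g)) := by
    rintro G Δ E β g α hE hβ rfl h δ (rfl | hδ) sδ
    · exact imp_of_singleton ⟨hE, hβ⟩ (.andElimR (self ⟨hE, hβ⟩))
    · exact .intTrans
        (imp_of_singleton ⟨hE, hβ⟩ (.andElimL (ψ := α.mapConst g) (self ⟨hE, hβ⟩))) (h δ hδ sδ)
  -- The hypotheses survive redirecting a constant that is foreign to the assumptions.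
  have redirect : ∀ {Γ Γ' : Set (Formula L.plus)} {P : Formula L.plus → Prop}
      {g : L.plus.Const → L.plus.Const} {i : ℕ} (j : ℕ), Γ' ⊆ Γ → FreshIn i Γ' →
      (∀ γ ∈ Γ, γ.Sentence → P (γ.mapConst g)) →
      ∀ γ ∈ Γ', γ.Sentence → P (γ.mapConst (Function.update g (aname L i) (aname L j))) := by
    intro Γ Γ' P g i j hsub hi h γ hγ sγ
    rw [Formula.mapConst_update (hi γ hγ)]
    exact h γ (hsub hγ) sγ
  induction h generalizing G g θ E with
  | hyp hmem hs =>
    rcases hmem with hmem | hmem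
    · have h := hΓ _ hmem hs
      exact h.or_map (.impIntro hE (.hyp (by simp) h.sentence.2))
    · exact .orIntroR hθ (hΔ _ hmem hs)
  | weaken h₁ h₂ _ ih =>
    exact ih hG g hθ hE (fun γ hγ => hΓ γ (h₁ hγ)) (fun δ hδ => hΔ δ (h₂ hδ))
  | topIntro => exact .orIntroR hθ (.impIntro hE .topIntro)
  | botElim hs _ ih =>
    exact (ih hG g hθ hE hΓ hΔ).or_imp_map (.botElim (hs.mapConst g) (self trivial))
  | andIntro _ _ ih₁ ih₂ => exact (ih₁ hG g hθ hE hΓ hΔ).or_imp_and (ih₂ hG g hθ hE hΓ hΔ)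
  | andElimL h ih =>
    exact (ih hG g hθ hE hΓ hΔ).or_imp_map (.andElimL (self (h.sentence.mapConst g)))
  | andElimR h ih =>
    exact (ih hG g hθ hE hΓ hΔ).or_imp_map (.andElimR (self (h.sentence.mapConst g)))
  | orIntroL hs h ih =>
    exact (ih hG g hθ hE hΓ hΔ).or_imp_map
      (.orIntroL (hs.mapConst g) (self (h.sentence.mapConst g)))
  | orIntroR hs h ih =>
    exact (ih hG g hθ hE hΓ hΔ).or_imp_map
      (.orIntroR (hs.mapConst g) (self (h.sentence.mapConst g)))
  | orElim h _ _ ih₁ ih₂ ih₃ =>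
    have sφ := Formula.Sentence.mapConst h.sentence.1 g
    have sψ := Formula.Sentence.mapConst h.sentence.2 g
    exact (ih₁ hG g hθ hE hΓ hΔ).or_imp_or_elim
      (ih₂ hG g hθ ⟨hE, sφ⟩ hΓ (extend _ hE sφ rfl hΔ))
      (ih₃ hG g hθ ⟨hE, sψ⟩ hΓ (extend _ hE sψ rfl hΔ))
  | impIntro hs _ ih =>
    exact or_imp_curry
      (ih hG g hθ ⟨hE, hs.mapConst g⟩ hΓ (extend _ hE (hs.mapConst g) rfl hΔ))
  | impElim _ _ ih₁ ih₂ =>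
    have h₁ := ih₁ hG g hθ hE hΓ hΔ
    have h₂ := or_of_or_box (ih₂ hG g hθ (E := .top) trivial hΓ (by simp))
    exact h₁.or_map₂ h₂
      (.intTrans (.hyp (by simp) h₁.sentence.2) (.hyp (.inr (.inr rfl)) h₂.sentence.2))
  | intTrans _ _ ih₁ ih₂ =>
    have h := (ih₁ hG g hθ hE hΓ hΔ).or_imp_and (ih₂ hG g hθ hE hΓ hΔ)
    have s := h.sentence.2.2
    exact h.or_imp_map (.intTrans (.andElimL (self s)) (.andElimR (self s)))
  | intAndIntro _ _ ih₁ ih₂ =>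
    have h := (ih₁ hG g hθ hE hΓ hΔ).or_imp_and (ih₂ hG g hθ hE hΓ hΔ)
    have s := h.sentence.2.2
    exact h.or_imp_map (.intAndIntro (.andElimL (self s)) (.andElimR (self s)))
  | intOrElim _ _ ih₁ ih₂ =>
    have h := (ih₁ hG g hθ hE hΓ hΔ).or_imp_and (ih₂ hG g hθ hE hΓ hΔ)
    have s := h.sentence.2.2
    exact h.or_imp_map (.intOrElim (.andElimL (self s)) (.andElimR (self s)))
  | intAllIntro hs h ih =>
    exact (ih hG g hθ hE hΓ hΔ).or_imp_map
      (.intAllIntro (hs.mapConst g) (self (h.sentence.mapConst g)))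
  | intExElim hs h ih =>
    exact (ih hG g hθ hE hΓ hΔ).or_imp_map
      (.intExElim (hs.mapConst g) (self (h.sentence.mapConst g)))
  | @allIntro Γ Δ Γ' Δ' φ i hΓ' hΔ' fΓ fΔ hφ h ih =>
    obtain ⟨j, jG, jθ, jE, jφ⟩ := ((eventually_freshIn hG).and (θ.eventually_not_occC.and
      (E.eventually_not_occC.and (φ.mapConst g).eventually_not_occC))).exists
    have key := ih hG (Function.update g (aname L i) (aname L j)) hθ hE
      (redirect (P := fun γ => Prf L G ∅ (.or θ γ)) j hΓ' fΓ hΓ)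
      (redirect (P := fun δ => Prf L G ∅ (.imp E δ)) j hΔ' fΔ hΔ)
    rw [mapConst_update_subst0_aconst hφ] at key
    exact or_imp_all_of_fresh jG jθ jE jφ key
  | allElim ht h ih =>
    rw [mapConst_subst0]
    exact (ih hG g hθ hE hΓ hΔ).or_imp_map
      (.allElim (Term.closedAt_mapConst.2 ht) (self (h.sentence.mapConst g)))
  | cd hs h ih =>
    exact (ih hG g hθ hE hΓ hΔ).or_imp_map (.cd (hs.mapConst g) (self (h.sentence.mapConst g)))
  | exIntro ht hs h ih =>
    have key := ih hG g hθ hE hΓ hΔ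
    rw [mapConst_subst0] at key
    exact key.or_imp_map
      (.exIntro (Term.closedAt_mapConst.2 ht) (hs.mapConst g) (self key.sentence.2.2))
  | @exElim Γ Δ Γ' Δ' φ ψ i hΓ' hΔ' fΓ fΔ hφ hψ h _ ih₁ ih₂ =>
    obtain ⟨j, jG, jθ, jE, jφ, jψ⟩ := ((eventually_freshIn hG).and (θ.eventually_not_occC.and
      (E.eventually_not_occC.and ((φ.mapConst g).eventually_not_occC.and
        (ψ.mapConst g).eventually_not_occC)))).exists
    have sj : (subst0 (φ.mapConst g) (aconst L j)).Sentence :=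
      sentence_subst0 (h.sentence.mapConst g) trivial
    have key := ih₂ hG (Function.update g (aname L i) (aname L j)) hθ
      (E := .and E (subst0 (φ.mapConst g) (aconst L j))) ⟨hE, sj⟩
      (redirect (P := fun γ => Prf L G ∅ (.or θ γ)) j hΓ' fΓ hΓ)
      (extend _ hE sj (mapConst_update_subst0_aconst hφ)
        (redirect (P := fun δ => Prf L G ∅ (.imp E δ)) j hΔ' fΔ hΔ))
    rw [Formula.mapConst_update hψ] at key
    exact or_imp_ex_elim_of_fresh jG jθ jE jφ jψ (ih₁ hG g hθ hE hΓ hΔ) key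

end Derivations

/-- If `χ` follows from `Γ`, then `θ ∨ χ` follows from the disjunctions of `θ` with the members of
`Γ`, even where these are used unsafely. -/
theorem Prf.or_replace {L : Signature} {Γ G : Set (Formula L.plus)} {θ χ : Formula L.plus}
    (h : Prf L Γ ∅ χ) (hG : G.Finite) (hθ : θ.Sentence)
    (hΓ : ∀ γ ∈ Γ, γ.Sentence → Prf L G ∅ (.or θ γ)) : Prf L G ∅ (.or θ χ) := by
  refine .or_of_or_box ?_
  have := h.or_imp_of_relativized hG id hθ (E := .top) trivial
    (by simpa only [Formula.mapConst_id] using hΓ) (by simp)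
  rwa [Formula.mapConst_id] at this

/-- **Unrestricted ∨-Elim** (Theorem 5): if `Γ ⊢ φ ∨ ψ`, `Γ, φ ⊢ χ` and `Γ, ψ ⊢ χ`,
then `Γ ⊢ χ`. -/
theorem unrestricted_or_elim {L : Signature} (Γ : Set (Formula L.plus))
    (φ ψ χ : Formula L.plus) (hΓ : ∀ α ∈ Γ, Formula.Sentence α)
    (hφ : φ.Sentence) (hψ : ψ.Sentence) (hχ : χ.Sentence)
    (h1 : Prv L Γ (.or φ ψ)) (h2 : Prv L (insert φ Γ) χ)
    (h3 : Prv L (insert ψ Γ) χ) : Prv L Γ χ := by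
  obtain ⟨G₁, hG₁, D₁, hD₁, fG₁, -, p₁⟩ := Prf.exists_finite h1
  obtain ⟨G₂, hG₂, D₂, hD₂, fG₂, -, p₂⟩ := Prf.exists_finite h2
  obtain ⟨G₃, hG₃, D₃, hD₃, fG₃, -, p₃⟩ := Prf.exists_finite h3
  obtain rfl := Set.subset_empty_iff.1 hD₁
  obtain rfl := Set.subset_empty_iff.1 hD₂
  obtain rfl := Set.subset_empty_iff.1 hD₃
  obtain ⟨G₂', hG₂', fG₂', hs₂⟩ := exists_finite_of_subset_insert fG₂ hG₂
  obtain ⟨G₃', hG₃', fG₃', hs₃⟩ := exists_finite_of_subset_insert fG₃ hG₃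
  have fG : (G₁ ∪ (G₂' ∪ G₃')).Finite := fG₁.union (fG₂'.union fG₃')
  set G := G₁ ∪ (G₂' ∪ G₃')
  have hψφ : Prf L G ∅ (.or ψ φ) :=
    .orElim (.weaken (by grind) subset_rfl p₁) (.orIntroR hψ (.hyp (by simp) hφ))
      (.orIntroL hφ (.hyp (by simp) hψ))
  have hψχ : Prf L G ∅ (.or ψ χ) := by
    refine p₂.or_replace fG hψ fun γ hγ sγ => ?_
    rcases hs₂ hγ with rfl | hγ
    · exact hψφ
    · exact .orIntroR hψ (.hyp (by grind) sγ)
  have hχψ : Prf L G ∅ (.or χ ψ) :=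
    .orElim hψχ (.orIntroR hχ (.hyp (by simp) hψ)) (.orIntroL hψ (.hyp (by simp) hχ))
  have hχχ : Prf L G ∅ (.or χ χ) := by
    refine p₃.or_replace fG hχ fun γ hγ sγ => ?_
    rcases hs₃ hγ with rfl | hγ
    · exact hχψ
    · exact .orIntroR hχ (.hyp (by grind) sγ)
  exact .weaken (by grind) subset_rfl
    (.orElim hχχ (.hyp (by simp) hχ) (.hyp (by simp) hχ))

end BQL
end
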